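/- Let K be a field in which 3 is invertible, let n ≥ 1, and consider the function f : M_n(K)³ → K, f(X,Y,Z) = trace(XYZ − XZY − (1/3)X³), a polynomial function in the 3n² matrix entries. Then all partial derivatives of f with respect to the entries of X, Y, Z vanish at a point (X,Y,Z) if and only if XY = YX, XZ = ZX, and YZ − ZY = X². Equivalently, the degeneracy locus of the Chern–Simons functional of the superpotential W = XYZ − XZY − (1/3)X³ is exactly the scheme of n-dimensional representations of the homogenized Weyl algebra K⟨X,Y,Z⟩/(XZ−ZX, XY−YX, YZ−ZY−X²). -/

import Mathlib

/-- The three generic `n × n` matrices whose entries are the polynomial variables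
indexed by `Fin 3 × Fin n × Fin n`. -/
noncomputable def genericMatrix3 (K : Type) [Field K] (n : ℕ) (a : Fin 3) :
    Matrix (Fin n) (Fin n) (MvPolynomial (Fin 3 × Fin n × Fin n) K) :=
  Matrix.of fun i j => MvPolynomial.X (a, i, j)

/-- The Chern–Simons functional of the homogenized Weyl superpotential
`W = XYZ − XZY − (1/3)X³` as a polynomial in the `3n²` matrix entries. -/
noncomputable def chernSimonsWeyl (K : Type) [Field K] (n : ℕ) :
    MvPolynomial (Fin 3 × Fin n × Fin n) K :=
  Matrix.trace
    (genericMatrix3 K n 0 * genericMatrix3 K n 1 * genericMatrix3 K n 2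
      - genericMatrix3 K n 0 * genericMatrix3 K n 2 * genericMatrix3 K n 1
      - (MvPolynomial.C (3 : K)⁻¹ : MvPolynomial (Fin 3 × Fin n × Fin n) K) • genericMatrix3 K n 0 ^ 3)

/-- The Leibniz rule for a derivation applied entrywise to a product of matrices. -/
theorem Matrix.map_derivation_mul {R S ι : Type*} [CommRing R] [CommRing S] [Algebra R S]
    [Fintype ι] (D : Derivation R S S) (A B : Matrix ι ι S) :
    (A * B).map D = A.map D * B + A * B.map D := by
  ext i j
  simp only [Matrix.map_apply, Matrix.mul_apply, Matrix.add_apply, map_sum, Derivation.leibniz,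
    smul_eq_mul, ← Finset.sum_add_distrib]
  refine Finset.sum_congr rfl fun k _ => ?_
  ring

/-- A derivation commutes with the trace. -/
theorem Matrix.derivation_trace {R S ι : Type*} [CommRing R] [CommRing S] [Algebra R S]
    [Fintype ι] (D : Derivation R S S) (A : Matrix ι ι S) :
    D A.trace = (A.map D).trace := by
  simp [Matrix.trace]

/-- The derivative of `Tr(ABC)`, in terms of the cyclic derivatives of `ABC`. -/
theorem Matrix.derivation_trace_mul_mul {R S ι : Type*} [CommRing R] [CommRing S] [Algebra R S]
    [Fintype ι] (D : Derivation R S S) (A B C : Matrix ι ι S) :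
    D (A * B * C).trace = (A.map D * (B * C)).trace + (B.map D * (C * A)).trace
      + (C.map D * (A * B)).trace := by
  rw [Matrix.derivation_trace, Matrix.map_derivation_mul, Matrix.map_derivation_mul,
    Matrix.add_mul, Matrix.trace_add, Matrix.trace_add, Matrix.mul_assoc,
    Matrix.trace_mul_cycle A, Matrix.trace_mul_comm (A * B), Matrix.trace_mul_comm (C * A)]

/-- Evaluating a generic matrix at a matrix triple gives the corresponding matrix. -/
theorem genericMatrix3_map_eval {K : Type} [Field K] {n : ℕ}
    (M : Fin 3 → Matrix (Fin n) (Fin n) K) (a : Fin 3) :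
    (genericMatrix3 K n a).map (MvPolynomial.eval fun u => M u.1 u.2.1 u.2.2) = M a := by
  ext i j
  simp [genericMatrix3]

/-- The partial derivatives of a generic matrix are elementary matrices. -/
theorem genericMatrix3_map_pderiv (K : Type) [Field K] {n : ℕ} (a b : Fin 3) (i j : Fin n) :
    (genericMatrix3 K n a).map (MvPolynomial.pderiv (b, i, j)) =
      if a = b then Matrix.single i j 1 else 0 := by
  classical
  ext k l
  by_cases h : a = b
  · simp [genericMatrix3, MvPolynomial.pderiv_X, Pi.single_apply, Matrix.single_apply, h,
      eq_comm]
  · simp [genericMatrix3, MvPolynomial.pderiv_X, h]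

/-- The gradient of the Chern–Simons functional is given by the cyclic derivatives of the
superpotential, evaluated at the generic matrices. -/
theorem pderiv_chernSimonsWeyl {K : Type} [Field K] (h3 : (3 : K) ≠ 0) {n : ℕ} (i j : Fin n) :
    MvPolynomial.pderiv (0, i, j) (chernSimonsWeyl K n) =
        (genericMatrix3 K n 1 * genericMatrix3 K n 2 - genericMatrix3 K n 2 * genericMatrix3 K n 1
          - genericMatrix3 K n 0 * genericMatrix3 K n 0) j i ∧
      MvPolynomial.pderiv (1, i, j) (chernSimonsWeyl K n) =
        (genericMatrix3 K n 2 * genericMatrix3 K n 0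
          - genericMatrix3 K n 0 * genericMatrix3 K n 2) j i ∧
      MvPolynomial.pderiv (2, i, j) (chernSimonsWeyl K n) =
        (genericMatrix3 K n 0 * genericMatrix3 K n 1
          - genericMatrix3 K n 1 * genericMatrix3 K n 0) j i := by
  have hC : (MvPolynomial.C (3 : K)⁻¹ : MvPolynomial (Fin 3 × Fin n × Fin n) K) * 3 = 1 := by
    rw [← map_ofNat (MvPolynomial.C (σ := Fin 3 × Fin n × Fin n) (R := K)) 3, ← map_mul,
      inv_mul_cancel₀ h3, map_one]
  rw [chernSimonsWeyl, Matrix.trace_sub, Matrix.trace_sub, Matrix.trace_smul, pow_three',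
    smul_eq_mul]
  simp only [map_sub, MvPolynomial.pderiv_C_mul, Matrix.derivation_trace_mul_mul,
    genericMatrix3_map_pderiv]
  refine ⟨?_, ?_, ?_⟩
  · simp [Matrix.trace_single_mul]
    linear_combination (genericMatrix3 K n 0 * genericMatrix3 K n 0) j i * hC
  · simp [Matrix.trace_single_mul]
  · simp [Matrix.trace_single_mul]

/-- The gradient of the Chern–Simons functional at a matrix triple. -/
theorem eval_pderiv_chernSimonsWeyl {K : Type} [Field K] (h3 : (3 : K) ≠ 0) {n : ℕ}
    (M : Fin 3 → Matrix (Fin n) (Fin n) K) (i j : Fin n) :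
    MvPolynomial.eval (fun u => M u.1 u.2.1 u.2.2)
        (MvPolynomial.pderiv (0, i, j) (chernSimonsWeyl K n)) =
          (M 1 * M 2 - M 2 * M 1 - M 0 * M 0) j i ∧
      MvPolynomial.eval (fun u => M u.1 u.2.1 u.2.2)
        (MvPolynomial.pderiv (1, i, j) (chernSimonsWeyl K n)) = (M 2 * M 0 - M 0 * M 2) j i ∧
      MvPolynomial.eval (fun u => M u.1 u.2.1 u.2.2)
        (MvPolynomial.pderiv (2, i, j) (chernSimonsWeyl K n)) = (M 0 * M 1 - M 1 * M 0) j i := by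
  obtain ⟨h0, h1, h2⟩ := pderiv_chernSimonsWeyl h3 i j
  have key (a b : Fin 3) : MvPolynomial.eval (fun u => M u.1 u.2.1 u.2.2)
      ((genericMatrix3 K n a * genericMatrix3 K n b) j i) = (M a * M b) j i := by
    rw [← Matrix.map_apply (f := MvPolynomial.eval _), Matrix.map_mul, genericMatrix3_map_eval,
      genericMatrix3_map_eval]
  simp only [h0, h1, h2, Matrix.sub_apply, map_sub, key, and_self]

/-- for a field `K` with `3` invertible, all partial derivatives of
`f(X,Y,Z) = Tr(XYZ − XZY − (1/3)X³)` vanish at `(X,Y,Z)` if and only if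
`XY = YX`, `XZ = ZX` and `YZ − ZY = X²`, i.e. the degeneracy locus of the Chern–Simons
functional is the representation scheme of the homogenized Weyl algebra. -/
theorem degeneracy_locus_homogenized_weyl
    (K : Type) [Field K] (h3 : (3 : K) ≠ 0) (n : ℕ) (hn : 1 ≤ n)
    (X Y Z : Matrix (Fin n) (Fin n) K) :
    (∀ v : Fin 3 × Fin n × Fin n,
        MvPolynomial.eval (fun u : Fin 3 × Fin n × Fin n => ![X, Y, Z] u.1 u.2.1 u.2.2)
          (MvPolynomial.pderiv v (chernSimonsWeyl K n)) = 0) ↔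
      (X * Y = Y * X ∧ X * Z = Z * X ∧ Y * Z - Z * Y = X ^ 2) := by
  have grad := eval_pderiv_chernSimonsWeyl h3 ![X, Y, Z]
  rw [pow_two]
  constructor
  · intro h
    refine ⟨sub_eq_zero.mp ?_, (sub_eq_zero.mp ?_).symm, sub_eq_zero.mp ?_⟩ <;> ext j i
    · exact (grad i j).2.2.symm.trans (h (2, i, j))
    · exact (grad i j).2.1.symm.trans (h (1, i, j))
    · exact (grad i j).1.symm.trans (h (0, i, j))
  · rintro ⟨hXY, hXZ, hYZ⟩ ⟨b, i, j⟩
    fin_cases b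
    · exact (grad i j).1.trans (congrFun₂ (sub_eq_zero.mpr hYZ) j i)
    · exact (grad i j).2.1.trans (congrFun₂ (sub_eq_zero.mpr hXZ.symm) j i)
    · exact (grad i j).2.2.trans (congrFun₂ (sub_eq_zero.mpr hXY) j i)
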